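/- Define the probabilistic prime counting function π̃(x) for real x ≥ 4 by: if k is the unique index with p_k^2 ≤ x < p_{k+1}^2, then π̃(x) := Σ_{j=1}^{k-1} l_j · Π_{p ≤ p_j}(1 - 1/p) + (x - p_k^2) · Π_{p ≤ p_k}(1 - 1/p). Then π̃(x) ~ 2e^{-γ} · li(x) as x → ∞, i.e. lim_{x→∞} π̃(x)/(2e^{-γ} li(x)) = 1. -/

import Mathlib

open Filter

/-- `li(x) := ∫_2^x dt / log t`. -/
noncomputable def li (x : ℝ) : ℝ := ∫ t in (2:ℝ)..x, 1 / Real.log t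

/-- Product over the first `j` primes, i.e. over all primes `p ≤ p_j`:
`∏_{p ≤ p_j} (1 - 1/p)`. -/
noncomputable def eulerProd (j : ℕ) : ℝ :=
  ∏ i ∈ Finset.range j, (1 - 1 / (Nat.nth Nat.Prime i : ℝ))

/-- The unique index `k` with `p_k^2 ≤ x < p_{k+1}^2` (for `x ≥ 4`), i.e. the number of
primes `p` with `p^2 ≤ x`. -/
noncomputable def sieveIndex (x : ℝ) : ℕ := Nat.primeCounting (Nat.sqrt ⌊x⌋₊)

/-- The probabilistic prime counting function
`π̃(x) := ∑_{j=1}^{k-1} l_j ∏_{p ≤ p_j}(1 - 1/p) + (x - p_k^2) ∏_{p ≤ p_k}(1 - 1/p)`,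
where `k = sieveIndex x`, `l_j = p_{j+1}^2 - p_j^2`, and `p_j = Nat.nth Nat.Prime (j-1)`. -/
noncomputable def ptilde (x : ℝ) : ℝ :=
  (∑ j ∈ Finset.range (sieveIndex x - 1),
      (((Nat.nth Nat.Prime (j + 1) : ℝ)) ^ 2 - ((Nat.nth Nat.Prime j : ℝ)) ^ 2) *
        eulerProd (j + 1)) +
    (x - ((Nat.nth Nat.Prime (sieveIndex x - 1) : ℝ)) ^ 2) * eulerProd (sieveIndex x)

open Finset ArithmeticFunction in
/-- Mertens' first theorem for the von Mangoldt function. -/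
lemma exists_abs_sum_vonMangoldt_div_sub_log_le :
    ∃ C : ℝ, ∀ N : ℕ, 1 ≤ N →
      |∑ n ∈ Ioc 0 N, vonMangoldt n / (n : ℝ) - Real.log N| ≤ C := by
  refine ⟨Real.log 4 + 4, fun N hN ↦ ?_⟩
  have hN0 : (0 : ℝ) < N := by exact_mod_cast hN
  have hfact : ∑ n ∈ Ioc 0 N, vonMangoldt n * ((N / n : ℕ) : ℝ) = Real.log N.factorial := by
    rw [← sum_Ioc_mul_zeta_eq_sum, vonMangoldt_mul_zeta, Nat.factorial_eq_prod_range_add_one,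
      Nat.cast_prod, Real.log_prod (fun i _ ↦ by positivity), Finset.range_eq_Ico,
      Finset.sum_Ico_add' (fun n : ℕ ↦ Real.log n) 0 N 1]
    exact Finset.sum_congr (by ext; simp; omega) fun _ _ ↦ by simp
  have hpsi := Chebyshev.psi_le_const_mul_self hN0.le
  have hpsi' : Chebyshev.psi N = ∑ n ∈ Ioc 0 N, vonMangoldt n := by simp [Chebyshev.psi]
  have hlow : Real.log N.factorial ≤ N * ∑ n ∈ Ioc 0 N, vonMangoldt n / (n : ℝ) := by
    rw [← hfact, mul_sum]
    refine sum_le_sum fun n _ ↦ ?_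
    calc vonMangoldt n * ((N / n : ℕ) : ℝ) ≤ vonMangoldt n * ((N : ℝ) / n) :=
          mul_le_mul_of_nonneg_left Nat.cast_div_le vonMangoldt_nonneg
      _ = _ := by ring
  have hup : N * ∑ n ∈ Ioc 0 N, vonMangoldt n / (n : ℝ)
      ≤ Real.log N.factorial + ∑ n ∈ Ioc 0 N, vonMangoldt n := by
    rw [← hfact, mul_sum, ← sum_add_distrib]
    refine sum_le_sum fun n hn ↦ ?_
    have hn0 : 0 < n := (mem_Ioc.mp hn).1
    have h1 : (N : ℝ) / n ≤ ((N / n : ℕ) : ℝ) + 1 := by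
      rw [div_le_iff₀ (by exact_mod_cast hn0)]
      have := (Nat.lt_mul_div_succ N hn0).le
      rw [mul_comm]
      exact_mod_cast this
    calc N * (vonMangoldt n / (n : ℝ)) = vonMangoldt n * ((N : ℝ) / n) := by ring
      _ ≤ vonMangoldt n * (((N / n : ℕ) : ℝ) + 1) :=
          mul_le_mul_of_nonneg_left h1 vonMangoldt_nonneg
      _ = _ := by ring
  have hfl := Stirling.le_log_factorial_stirling (n := N) (by omega)
  have hfu : Real.log N.factorial ≤ N * Real.log N := by
    rw [← Real.log_pow]
    exact Real.log_le_log (by positivity) (by exact_mod_cast Nat.factorial_le_pow N)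
  have hl2 : 0 ≤ Real.log (2 * Real.pi) := Real.log_nonneg (by linarith [Real.pi_gt_three])
  have hlN : 0 ≤ Real.log N := Real.log_nonneg (by exact_mod_cast hN)
  have hl4 : 0 ≤ Real.log 4 := Real.log_nonneg (by norm_num)
  set S := ∑ n ∈ Ioc 0 N, vonMangoldt n / (n : ℝ)
  rw [abs_le]
  constructor
  · refine le_of_mul_le_mul_left (a := (N : ℝ)) ?_ hN0
    nlinarith
  · refine le_of_mul_le_mul_left (a := (N : ℝ)) ?_ hN0
    nlinarith

open Finset ArithmeticFunction in
/-- Mertens' first theorem: `∑_{p ≤ N} log p / p = log N + O(1)`. -/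
lemma exists_abs_sum_prime_log_div_sub_log_le :
    ∃ C : ℝ, ∀ N : ℕ, 1 ≤ N →
      |∑ n ∈ range (N + 1), (if n.Prime then Real.log n / n else 0) - Real.log N| ≤ C := by
  obtain ⟨C, hC⟩ := exists_abs_sum_vonMangoldt_div_sub_log_le
  have hs := vonMangoldt.summable_residueClass_non_primes_div (q := 1) 0
  set g : ℕ → ℝ := fun n ↦ (if n.Prime then 0 else vonMangoldt.residueClass (0 : ZMod 1) n) / n
    with hg
  have hres (n : ℕ) : vonMangoldt.residueClass (0 : ZMod 1) n = vonMangoldt n :=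
    Set.indicator_of_mem (s := {m : ℕ | (m : ZMod 1) = 0}) (Subsingleton.elim (n : ZMod 1) 0) _
  have hg0 (n : ℕ) : 0 ≤ g n := by
    simp only [hg, hres]
    split_ifs <;> positivity [vonMangoldt_nonneg (n := n)]
  refine ⟨C + ∑' n, g n, fun N hN ↦ ?_⟩
  have hsplit : ∑ n ∈ Ioc 0 N, vonMangoldt n / (n : ℝ)
      = ∑ n ∈ range (N + 1), (if n.Prime then Real.log n / n else 0)
        + ∑ n ∈ range (N + 1), g n := by
    rw [← sum_add_distrib, Finset.sum_range_eq_add_Ico _ (Nat.succ_pos N)]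
    have : Ico 1 (N + 1) = Ioc 0 N := by ext; simp; omega
    rw [this]
    simp only [hg, hres]
    norm_num
    refine sum_congr rfl fun n _ ↦ ?_
    split_ifs with h
    · simp [vonMangoldt_apply_prime h]
    · simp
  have h1 := hC N hN
  have h2 : ∑ n ∈ range (N + 1), g n ≤ ∑' n, g n := hs.sum_le_tsum _ fun n _ ↦ hg0 n
  have h3 : 0 ≤ ∑ n ∈ range (N + 1), g n := sum_nonneg fun n _ ↦ hg0 n
  rw [hsplit, abs_le] at h1
  rw [abs_le]
  constructor <;> linarith

open Finset in
/-- Mertens' second theorem: `∑_{p < n} 1 / p - log (log n)` converges. -/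
lemma exists_tendsto_sum_prime_inv_sub_log_log :
    ∃ M : ℝ, Tendsto (fun n : ℕ ↦ ∑ i ∈ range n, (if i.Prime then 1 / (i : ℝ) else 0)
      - Real.log (Real.log n)) atTop (nhds M) := by
  obtain ⟨C, hC⟩ := exists_abs_sum_prime_log_div_sub_log_le
  set pw : ℕ → ℝ := fun n ↦ if n.Prime then Real.log n / n else 0 with hpw
  set d : ℕ → ℝ := fun i ↦ Real.log (i + 3) - Real.log (i + 2) with hd
  set e : ℕ → ℝ := fun i ↦
    Real.log (i + 2) * (Real.log (Real.log (i + 3)) - Real.log (Real.log (i + 2))) with he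
  have hlog2 (i : ℕ) : 0 < Real.log (i + 2) :=
    Real.log_pos (by have : (0 : ℝ) ≤ i := i.cast_nonneg; linarith)
  have hlog3 (i : ℕ) : 1 ≤ Real.log (i + 3) := by
    rw [Real.le_log_iff_exp_le (by positivity)]
    have : (0 : ℝ) ≤ i := i.cast_nonneg
    linarith [Real.exp_one_lt_d9]
  have hd0 (i : ℕ) : 0 ≤ d i := sub_nonneg.mpr (Real.log_le_log (by positivity) (by linarith))
  have hd1 (i : ℕ) : d i ≤ 1 / (i + 2) := by
    simp only [hd]
    rw [← Real.log_div (by positivity) (by positivity)]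
    refine (Real.log_le_sub_one_of_pos (by positivity)).trans (le_of_eq ?_)
    field_simp
    ring
  have hed (i : ℕ) : e i ≤ d i := by
    have h := Real.log_le_sub_one_of_pos (div_pos (zero_lt_one.trans_le (hlog3 i)) (hlog2 i))
    rw [Real.log_div (by linarith [hlog3 i]) (hlog2 i).ne'] at h
    calc e i ≤ Real.log (i + 2) * (Real.log (i + 3) / Real.log (i + 2) - 1) :=
          mul_le_mul_of_nonneg_left h (hlog2 i).le
      _ = d i := by simp only [hd]; field_simp [(hlog2 i).ne']
  have hde (i : ℕ) : d i - e i ≤ 1 / ((i : ℝ) + 2) ^ 2 := by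
    have hpos := zero_lt_one.trans_le (hlog3 i)
    have h := Real.one_sub_inv_le_log_of_pos (div_pos hpos (hlog2 i))
    rw [Real.log_div hpos.ne' (hlog2 i).ne', inv_div] at h
    have h2 : Real.log (i + 2) * (1 - Real.log (i + 2) / Real.log (i + 3)) ≤ e i :=
      mul_le_mul_of_nonneg_left h (hlog2 i).le
    have h3 : d i - Real.log (i + 2) * (1 - Real.log (i + 2) / Real.log (i + 3))
        = d i ^ 2 / Real.log (i + 3) := by
      simp only [hd]; field_simp [hpos.ne']
    have h4 : d i ^ 2 / Real.log (i + 3) ≤ d i ^ 2 := div_le_self (sq_nonneg _) (hlog3 i)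
    have h5 : d i ^ 2 ≤ (1 / ((i : ℝ) + 2)) ^ 2 := pow_le_pow_left₀ (hd0 i) (hd1 i) 2
    rw [one_div_pow] at h5
    linarith
  have hsum : Summable fun i : ℕ ↦ 1 / ((i : ℝ) + 2) ^ 2 := by
    have := (summable_nat_add_iff 2).mpr (Real.summable_one_div_nat_pow.mpr one_lt_two)
    simpa using this
  have hdsum (n : ℕ) : ∑ i ∈ range n, d i = Real.log (n + 2) - Real.log 2 := by
    have := Finset.sum_range_sub (fun i : ℕ ↦ Real.log (i + 2)) n
    simp only [Nat.cast_add, Nat.cast_one, Nat.cast_zero, zero_add] at this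
    rw [← this]
    refine sum_congr rfl fun i _ ↦ ?_
    simp only [hd]; ring_nf
  have hshift (F : ℕ → ℝ) (n : ℕ) (h0 : F 0 = 0) (h1 : F 1 = 0) :
      ∑ i ∈ range n, F (i + 2) = ∑ i ∈ range (n + 2), F i := by
    rw [Finset.sum_range_succ', Finset.sum_range_succ', h0, h1]; simp
  have hbound (n : ℕ) : ‖∑ i ∈ range n, (pw (i + 2) - e i)‖
      ≤ C + Real.log 2 + ∑' i : ℕ, 1 / ((i : ℝ) + 2) ^ 2 := by
    have h1 := hC (n + 1) (by omega)
    rw [← hshift pw n (by simp [hpw, Nat.not_prime_zero]) (by simp [hpw, Nat.not_prime_one])] at h1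
    have h2 : ∑ i ∈ range n, (d i - e i) ≤ ∑' i : ℕ, 1 / ((i : ℝ) + 2) ^ 2 :=
      (sum_le_sum fun i _ ↦ hde i).trans (hsum.sum_le_tsum _ fun i _ ↦ by positivity)
    have h3 : 0 ≤ ∑ i ∈ range n, (d i - e i) := sum_nonneg fun i _ ↦ sub_nonneg.mpr (hed i)
    rw [sum_sub_distrib, hdsum] at h2 h3
    rw [sum_sub_distrib, Real.norm_eq_abs]
    push_cast at h1
    have h4 : Real.log (n + 1) ≤ Real.log (n + 2) :=
      Real.log_le_log (by positivity) (by linarith)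
    have h5 : Real.log (n + 2) ≤ Real.log (n + 1) + Real.log 2 := by
      rw [← Real.log_mul (by positivity) (by positivity)]
      exact Real.log_le_log (by positivity) (by have : (0 : ℝ) ≤ n := n.cast_nonneg; linarith)
    rw [abs_le] at h1 ⊢
    constructor <;> linarith
  have hanti : Antitone fun i : ℕ ↦ 1 / Real.log ((i : ℝ) + 2) := fun i j hij ↦
    one_div_le_one_div_of_le (hlog2 i) (Real.log_le_log (by positivity)
      (by have : (i : ℝ) ≤ j := by exact_mod_cast hij
          linarith))
  have hzero : Tendsto (fun i : ℕ ↦ 1 / Real.log ((i : ℝ) + 2)) atTop (nhds 0) := by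
    simp only [one_div]
    exact (Real.tendsto_log_atTop.comp
      (tendsto_natCast_atTop_atTop.atTop_add tendsto_const_nhds)).inv_tendsto_atTop
  obtain ⟨M, hM⟩ := cauchySeq_tendsto_of_complete
    (hanti.cauchySeq_series_mul_of_tendsto_zero_of_bounded hzero hbound)
  refine ⟨M - Real.log (Real.log 2), (tendsto_add_atTop_iff_nat 2).mp ?_⟩
  refine (hM.sub_const _).congr fun n ↦ ?_
  have hterm (i : ℕ) : (1 / Real.log ((i : ℝ) + 2)) • (pw (i + 2) - e i)
      = (if (i + 2).Prime then 1 / ((i + 2 : ℕ) : ℝ) else 0)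
        - (Real.log (Real.log ((i + 1 : ℕ) + 2)) - Real.log (Real.log (i + 2))) := by
    have := (hlog2 i).ne'
    have h3 : ((i + 1 : ℕ) : ℝ) + 2 = i + 3 := by push_cast; ring
    simp only [hpw, he, smul_eq_mul, h3]
    split_ifs
    · push_cast
      field_simp
    · field_simp
      ring
  simp_rw [hterm]
  rw [sum_sub_distrib, Finset.sum_range_sub (fun i : ℕ ↦ Real.log (Real.log ((i : ℝ) + 2))) n,
    hshift (fun i ↦ if i.Prime then 1 / (i : ℝ) else 0) n (by simp) (by simp [Nat.not_prime_one])]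
  push_cast
  simp only [zero_add]
  ring
open MeasureTheory Set in
/-- A Dirichlet series with exponents `l i` is the Laplace transform of its coefficient sum. -/
lemma hasSum_mul_exp_neg_integral {ι : Type*} [Countable ι] {a l : ι → ℝ} {D : ℝ → ℝ}
    (hl : ∀ i, 0 ≤ l i) (hD : ∀ u, HasSum (fun i ↦ if l i ≤ u then a i else 0) (D u))
    {s : ℝ} (hs : 0 < s) (hsum : Summable fun i ↦ |a i| * Real.exp (-(s * l i))) :
    HasSum (fun i ↦ a i * Real.exp (-(s * l i)))
      (∫ v in Ici (0 : ℝ), D (v / s) * Real.exp (-v)) := by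
  set F : ι → ℝ → ℝ := fun i ↦ (Ici (s * l i)).indicator fun v ↦ a i * Real.exp (-v) with hF
  have hexp (c : ℝ) : IntegrableOn (fun v ↦ Real.exp (-v)) (Ici c) :=
    (integrableOn_Ici_iff_integrableOn_Ioi).mpr (integrableOn_exp_neg_Ioi c)
  have hinter (i : ι) : Ici (0 : ℝ) ∩ Ici (s * l i) = Ici (s * l i) :=
    inter_eq_right.mpr (Ici_subset_Ici.mpr (mul_nonneg hs.le (hl i)))
  have hval (c : ℝ) (i : ι) : ∫ v in Ici (0 : ℝ),
      (Ici (s * l i)).indicator (fun v ↦ c * Real.exp (-v)) v = c * Real.exp (-(s * l i)) := by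
    rw [setIntegral_indicator measurableSet_Ici, hinter, integral_Ici_eq_integral_Ioi,
      integral_const_mul, integral_exp_neg_Ioi]
  have hint (i : ι) : Integrable (F i) (volume.restrict (Ici 0)) :=
    (((hexp 0).const_mul (a i)).indicator measurableSet_Ici)
  have hnorm (i : ι) (v : ℝ) :
      ‖F i v‖ = (Ici (s * l i)).indicator (fun v ↦ |a i| * Real.exp (-v)) v := by
    simp only [hF, norm_indicator_eq_indicator_norm]
    simp
  have key := hasSum_integral_of_summable_integral_norm hint
    (by simpa only [hnorm, hval] using hsum)
  simp only [hF, hval] at key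
  have heq : EqOn (fun v ↦ D (v / s) * Real.exp (-v)) (fun v ↦ ∑' i, F i v) (Ici 0) := by
    intro v _
    dsimp only
    rw [← ((hD (v / s)).mul_right (Real.exp (-v))).tsum_eq]
    refine tsum_congr fun i ↦ ?_
    simp only [hF, indicator_apply, mem_Ici, le_div_iff₀ hs, mul_comm (l i) s]
    split_ifs <;> simp
  rw [setIntegral_congr_fun measurableSet_Ici heq]
  exact key

open MeasureTheory Set Topology in
/-- Abelian theorem: if `D` tends to `δ` at infinity then so does its Abel mean. -/
lemma tendsto_integral_comp_div_mul_exp_neg {D : ℝ → ℝ} (hm : Measurable D) {B δ : ℝ}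
    (hB : ∀ u, 0 ≤ u → |D u| ≤ B) (hD : Tendsto D atTop (𝓝 δ)) :
    Tendsto (fun s : ℝ ↦ ∫ v in Ici (0 : ℝ), D (v / s) * Real.exp (-v)) (𝓝[>] 0) (𝓝 δ) := by
  have hexp : IntegrableOn (fun v ↦ Real.exp (-v)) (Ici (0 : ℝ)) :=
    (integrableOn_Ici_iff_integrableOn_Ioi).mpr (integrableOn_exp_neg_Ioi 0)
  have hδ : ∫ v in Ici (0 : ℝ), δ * Real.exp (-v) = δ := by
    rw [integral_Ici_eq_integral_Ioi, integral_const_mul, integral_exp_neg_Ioi_zero, mul_one]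
  rw [show 𝓝 δ = 𝓝 (∫ v in Ici (0 : ℝ), δ * Real.exp (-v)) by rw [hδ]]
  refine tendsto_integral_filter_of_dominated_convergence (fun v ↦ B * Real.exp (-v)) ?_ ?_
    (hexp.const_mul B) ?_
  · exact Eventually.of_forall fun s ↦ by fun_prop
  · filter_upwards [self_mem_nhdsWithin] with s hs
    filter_upwards [ae_restrict_mem measurableSet_Ici] with v hv
    rw [norm_mul, Real.norm_eq_abs, Real.norm_of_nonneg (Real.exp_pos _).le]
    exact mul_le_mul_of_nonneg_right (hB _ (div_nonneg hv (le_of_lt hs))) (Real.exp_pos _).le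
  · have : ∀ᵐ v ∂(volume.restrict (Ici (0 : ℝ))), v ≠ 0 :=
      ae_restrict_of_ae (Measure.ae_ne volume 0)
    filter_upwards [ae_restrict_mem measurableSet_Ici, this] with v hv hv0
    have hpos : 0 < v := lt_of_le_of_ne hv hv0.symm
    have hdiv : Tendsto (fun s : ℝ ↦ v / s) (𝓝[>] 0) atTop := by
      simpa only [div_eq_mul_inv] using tendsto_inv_nhdsGT_zero.const_mul_atTop hpos
    exact (hD.comp hdiv).mul_const _

lemma neg_log_one_sub_sub_nonneg {x : ℝ} (h1 : x < 1) :
    0 ≤ -Real.log (1 - x) - x := by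
  have := Real.log_le_sub_one_of_pos (sub_pos.mpr h1)
  linarith

lemma neg_log_one_sub_sub_le {x : ℝ} (h1 : x ≤ 1 / 2) :
    -Real.log (1 - x) - x ≤ 2 * x ^ 2 := by
  have hpos : 0 < 1 - x := by linarith
  have := Real.one_sub_inv_le_log_of_pos hpos
  have h2 : (1 - x)⁻¹ ≤ 1 + x + 2 * x ^ 2 := by
    rw [inv_le_iff_one_le_mul₀ hpos]
    nlinarith [sq_nonneg x]
  linarith

/-- The summand `-log (1 - 1 / p)` at primes `p`, and `0` elsewhere. -/
noncomputable def primeWeight (n : ℕ) : ℝ :=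
  if n.Prime then -Real.log (1 - 1 / (n : ℝ)) else 0

lemma Nat.Prime.one_div_le_half {p : ℕ} (hp : p.Prime) : 1 / (p : ℝ) ≤ 1 / 2 :=
  one_div_le_one_div_of_le two_pos (by exact_mod_cast hp.two_le)

lemma primeWeight_nonneg (n : ℕ) : 0 ≤ primeWeight n := by
  unfold primeWeight
  split_ifs with h
  · have := neg_log_one_sub_sub_nonneg (h.one_div_le_half.trans_lt one_half_lt_one)
    have : 0 ≤ 1 / (n : ℝ) := by positivity
    linarith
  · exact le_rfl

lemma primeWeight_le (n : ℕ) : primeWeight n ≤ 2 / n := by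
  unfold primeWeight
  split_ifs with h
  · have h1 := neg_log_one_sub_sub_le h.one_div_le_half
    have h2 := h.one_div_le_half
    have h3 : 0 ≤ 1 / (n : ℝ) := by positivity
    have h4 : 2 / (n : ℝ) = 2 * (1 / n) := by ring
    rw [h4]
    nlinarith
  · positivity

open Finset in
/-- The sums `∑_{p < n} -log (1 - 1 / p)` are `log (log n)` plus a convergent sequence. -/
lemma exists_tendsto_sum_primeWeight_sub_log_log :
    ∃ c : ℝ, Tendsto (fun n : ℕ ↦ ∑ i ∈ range n, primeWeight i - Real.log (Real.log n))
      atTop (nhds c) := by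
  obtain ⟨M, hM⟩ := exists_tendsto_sum_prime_inv_sub_log_log
  have hs : Summable fun n : ℕ ↦ primeWeight n - (if n.Prime then 1 / (n : ℝ) else 0) := by
    refine Summable.of_nonneg_of_le (fun n ↦ ?_) (fun n ↦ ?_)
      ((Real.summable_one_div_nat_pow.mpr one_lt_two).mul_left 2)
    · unfold primeWeight
      split_ifs with h
      · exact neg_log_one_sub_sub_nonneg (h.one_div_le_half.trans_lt one_half_lt_one)
      · simp
    · unfold primeWeight
      split_ifs with h
      · simpa only [one_div_pow] using
          neg_log_one_sub_sub_le h.one_div_le_half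
      · simp
  refine ⟨_, (hM.add hs.hasSum.tendsto_sum_nat).congr fun n ↦ ?_⟩
  rw [sum_sub_distrib]
  ring

lemma Nat.Prime.rpow_neg_one_add_le_half {p : ℕ} (hp : p.Prime) {s : ℝ} (hs : 0 ≤ s) :
    (p : ℝ) ^ (-(1 + s)) ≤ 1 / 2 := by
  refine le_trans ?_ hp.one_div_le_half
  rw [one_div, ← Real.rpow_neg_one]
  exact Real.rpow_le_rpow_of_exponent_le (by exact_mod_cast hp.one_le) (by linarith)

lemma summable_prime_neg_log_one_sub {s : ℝ} (hs : 0 < s) :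
    Summable fun n : ℕ ↦ if n.Prime then -Real.log (1 - (n : ℝ) ^ (-(1 + s))) else 0 := by
  have hsum : Summable fun n : ℕ ↦ (n : ℝ) ^ (-(1 + s)) :=
    Real.summable_nat_rpow.mpr (by linarith)
  refine Summable.of_nonneg_of_le (fun n ↦ ?_) (fun n ↦ ?_) (hsum.mul_left 2)
  · split_ifs with h
    · have := neg_log_one_sub_sub_nonneg
        ((h.rpow_neg_one_add_le_half hs.le).trans_lt one_half_lt_one)
      have : 0 ≤ (n : ℝ) ^ (-(1 + s)) := by positivity
      linarith
    · exact le_rfl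
  · have h0 : 0 ≤ (n : ℝ) ^ (-(1 + s)) := by positivity
    split_ifs with h
    · have h1 := h.rpow_neg_one_add_le_half hs.le
      nlinarith [neg_log_one_sub_sub_le h1]
    · positivity

/-- For `s > 0`, `∑_p -log (1 - p ^ (-(1 + s))) = log ζ(1 + s)`. -/
lemma exp_tsum_prime_neg_log_one_sub {s : ℝ} (hs : 0 < s) :
    Real.exp (∑' n : ℕ, if n.Prime then -Real.log (1 - (n : ℝ) ^ (-(1 + s))) else 0)
      = ∑' n : ℕ, 1 / (n : ℝ) ^ (1 + s) := by
  have hsum : Summable fun n : ℕ ↦ (n : ℝ) ^ (-(1 + s)) :=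
    Real.summable_nat_rpow.mpr (by linarith)
  let f : ℕ →*₀ ℝ :=
    { toFun := fun n ↦ (n : ℝ) ^ (-(1 + s))
      map_zero' := by rw [Nat.cast_zero, Real.zero_rpow (by linarith)]
      map_one' := by simp
      map_mul' := fun m n ↦ by
        push_cast
        exact Real.mul_rpow m.cast_nonneg n.cast_nonneg }
  have hprod := EulerProduct.eulerProduct_completely_multiplicative_hasProd (f := f)
    (hsum.congr fun n ↦ (Real.norm_of_nonneg (by positivity : 0 ≤ (n : ℝ) ^ (-(1 + s)))).symm)
  have hsp : HasSum (fun p : Nat.Primes ↦ -Real.log (1 - (p : ℝ) ^ (-(1 + s))))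
      (∑' n : ℕ, if n.Prime then -Real.log (1 - (n : ℝ) ^ (-(1 + s))) else 0) :=
    (hasSum_subtype_iff_indicator (s := {n : ℕ | n.Prime})
      (f := fun n : ℕ ↦ -Real.log (1 - (n : ℝ) ^ (-(1 + s))))).mpr
      ((summable_prime_neg_log_one_sub hs).hasSum.congr_fun fun n ↦ by
        simp [Set.indicator_apply])
  have huniq := hsp.rexp.unique (hprod.congr_fun fun p ↦ ?_)
  · rw [huniq]
    refine tsum_congr fun n ↦ ?_
    change (n : ℝ) ^ (-(1 + s)) = _
    rw [Real.rpow_neg n.cast_nonneg, one_div]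
  · have := p.2.rpow_neg_one_add_le_half hs.le
    change Real.exp (-Real.log (1 - (p : ℝ) ^ (-(1 + s)))) = (1 - (p : ℝ) ^ (-(1 + s)))⁻¹
    rw [Real.exp_neg, Real.exp_log (by linarith)]

open Topology in
lemma tendsto_tsum_prime_neg_log_one_sub_add_log :
    Tendsto (fun s : ℝ ↦
      (∑' n : ℕ, if n.Prime then -Real.log (1 - (n : ℝ) ^ (-(1 + s))) else 0) + Real.log s)
      (𝓝[>] 0) (𝓝 0) := by
  have hshift : Tendsto (fun s : ℝ ↦ 1 + s) (𝓝[>] 0) (𝓝[>] 1) := by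
    refine tendsto_nhdsWithin_iff.mpr ⟨?_, ?_⟩
    · have : Tendsto (fun s : ℝ ↦ 1 + s) (𝓝 0) (𝓝 (1 + 0)) :=
        (continuous_const.add continuous_id).tendsto 0
      rw [add_zero] at this
      exact this.mono_left nhdsWithin_le_nhds
    · filter_upwards [self_mem_nhdsWithin] with s hs
      simpa using hs
  have h := (tendsto_sub_mul_tsum_nat_rpow.comp hshift).log one_ne_zero
  rw [Real.log_one] at h
  refine h.congr' ?_
  filter_upwards [self_mem_nhdsWithin] with s hs
  have hs : 0 < s := hs
  simp only [Function.comp_apply, add_sub_cancel_left, ← exp_tsum_prime_neg_log_one_sub hs]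
  rw [Real.log_mul hs.ne' (Real.exp_pos _).ne', Real.log_exp, add_comm]

lemma Nat.Prime.exp_neg_mul_log {p : ℕ} (hp : p.Prime) (s : ℝ) :
    Real.exp (-(s * Real.log p)) = (p : ℝ) ^ (-s) := by
  rw [Real.rpow_def_of_pos (by exact_mod_cast hp.pos)]
  ring_nf

lemma Nat.Prime.rpow_neg_one_add {p : ℕ} (hp : p.Prime) (s : ℝ) :
    (p : ℝ) ^ (-(1 + s)) = 1 / p * (p : ℝ) ^ (-s) := by
  rw [neg_add, Real.rpow_add (by exact_mod_cast hp.pos), Real.rpow_neg_one, one_div]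

lemma summable_primeWeight_mul_exp {s : ℝ} (hs : 0 < s) :
    Summable fun n : ℕ ↦ primeWeight n * Real.exp (-(s * Real.log n)) := by
  refine Summable.of_nonneg_of_le
    (fun n ↦ mul_nonneg (primeWeight_nonneg n) (Real.exp_pos _).le) (fun n ↦ ?_)
    ((Real.summable_nat_rpow.mpr (by linarith : -(1 + s) < -1)).mul_left 2)
  by_cases hn : n.Prime
  · rw [hn.exp_neg_mul_log, hn.rpow_neg_one_add, ← mul_assoc, mul_one_div]
    exact mul_le_mul_of_nonneg_right (primeWeight_le n) (by positivity)
  · simp only [primeWeight, hn, if_false, zero_mul]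
    positivity

open Topology in
/-- `∑_p -log (1 - 1 / p) p ^ (-s) = -log s + o(1)` as `s → 0⁺`. -/
lemma tendsto_tsum_primeWeight_mul_exp_add_log :
    Tendsto (fun s : ℝ ↦ (∑' n : ℕ, primeWeight n * Real.exp (-(s * Real.log n))) + Real.log s)
      (𝓝[>] 0) (𝓝 0) := by
  set Δ : ℝ → ℕ → ℝ := fun s n ↦ primeWeight n * Real.exp (-(s * Real.log n))
    - (if n.Prime then -Real.log (1 - (n : ℝ) ^ (-(1 + s))) else 0) with hΔ
  have hlim : Tendsto (fun s ↦ ∑' n, Δ s n) (𝓝[>] 0) (𝓝 (∑' _ : ℕ, (0 : ℝ))) := by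
    refine tendsto_tsum_of_dominated_convergence
      ((Real.summable_one_div_nat_pow.mpr one_lt_two).mul_left 2) (fun n ↦ ?_) ?_
    · by_cases hn : n.Prime
      · have hcont : ContinuousAt (fun s ↦ Δ s n) 0 := by
          have hn0 : (n : ℝ) ≠ 0 := by exact_mod_cast hn.ne_zero
          have h1 : (1 : ℝ) - (n : ℝ) ^ (-(1 + (0 : ℝ))) ≠ 0 := by
            have := hn.rpow_neg_one_add_le_half (le_refl (0 : ℝ))
            exact (sub_pos.mpr (this.trans_lt one_half_lt_one)).ne'
          simp only [hΔ, hn, if_true]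
          have h2 : ContinuousAt (fun s : ℝ ↦ (n : ℝ) ^ (-(1 + s))) 0 :=
            (Real.continuous_const_rpow hn0).continuousAt.comp (by fun_prop)
          exact ContinuousAt.sub (by fun_prop) ((continuousAt_const.sub h2).log h1).neg
        have hz : Δ 0 n = 0 := by
          simp only [hΔ, primeWeight, hn, if_true]
          simp [Real.rpow_neg_one]
        have := hcont.tendsto
        rw [hz] at this
        exact this.mono_left nhdsWithin_le_nhds
      · simp [hΔ, primeWeight, hn]
    · filter_upwards [self_mem_nhdsWithin] with s hs n
      have hs : 0 < s := hs
      by_cases hn : n.Prime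
      · simp only [hΔ, primeWeight, hn, if_true]
        rw [hn.exp_neg_mul_log]
        set x : ℝ := 1 / n with hx
        set q : ℝ := (n : ℝ) ^ (-s) with hq
        have hy : (n : ℝ) ^ (-(1 + s)) = x * q := hn.rpow_neg_one_add s
        have hx0 : 0 ≤ x := by positivity
        have hq0 : 0 ≤ q := by positivity
        have hq1 : q ≤ 1 :=
          Real.rpow_le_one_of_one_le_of_nonpos (by exact_mod_cast hn.one_le) (by linarith)
        have hyx : x * q ≤ x := mul_le_of_le_one_right hx0 hq1
        have hx2 : x ≤ 1 / 2 := hn.one_div_le_half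
        have a1 := neg_log_one_sub_sub_nonneg (hx2.trans_lt one_half_lt_one)
        have a2 := neg_log_one_sub_sub_le hx2
        have b1 := neg_log_one_sub_sub_nonneg ((hyx.trans hx2).trans_lt one_half_lt_one)
        have b2 := neg_log_one_sub_sub_le (hyx.trans hx2)
        have hsq : (x * q) ^ 2 ≤ x ^ 2 := pow_le_pow_left₀ (by positivity) hyx 2
        have hxx : 1 / (n : ℝ) ^ 2 = x ^ 2 := by rw [hx, one_div_pow]
        rw [hy, hxx, Real.norm_eq_abs, abs_le]
        have c1 : 0 ≤ (-Real.log (1 - x) - x) * q := mul_nonneg a1 hq0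
        have c2 : (-Real.log (1 - x) - x) * q ≤ 2 * x ^ 2 :=
          (mul_le_of_le_one_right a1 hq1).trans a2
        constructor <;> linarith
      · simp only [hΔ, primeWeight, hn, if_false, zero_mul, sub_zero, norm_zero]
        positivity
  rw [tsum_zero] at hlim
  have h := hlim.add tendsto_tsum_prime_neg_log_one_sub_add_log
  rw [add_zero] at h
  refine h.congr' ?_
  filter_upwards [self_mem_nhdsWithin] with s hs
  simp only [hΔ]
  rw [(summable_primeWeight_mul_exp hs).tsum_sub (summable_prime_neg_log_one_sub hs)]
  ring

lemma hasSum_one_div_mul_exp {s : ℝ} (hs : 0 < s) :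
    HasSum (fun m : ℕ ↦ 1 / (m : ℝ) * Real.exp (-(s * m))) (-Real.log (1 - Real.exp (-s))) := by
  have h := Real.hasSum_pow_div_log_of_abs_lt_one (x := Real.exp (-s))
    (by rw [abs_of_pos (Real.exp_pos _), Real.exp_lt_one_iff]; linarith)
  rw [← hasSum_nat_add_iff' 1]
  simp only [Finset.sum_range_one, Nat.cast_zero, div_zero, zero_mul, sub_zero]
  refine h.congr_fun fun m ↦ ?_
  rw [← Real.exp_nat_mul, one_div_mul_eq_div]
  push_cast
  ring_nf

open Topology in
/-- `∑_m e ^ (-s m) / m = -log s + o(1)` as `s → 0⁺`. -/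
lemma tendsto_neg_log_one_sub_exp_neg_add_log :
    Tendsto (fun s : ℝ ↦ -Real.log (1 - Real.exp (-s)) + Real.log s) (𝓝[>] 0) (𝓝 0) := by
  have hder : HasDerivAt (fun s : ℝ ↦ -Real.exp (-s)) 1 0 := by
    have := (hasDerivAt_neg (0 : ℝ)).exp.fun_neg
    simpa using this
  have h := hder.tendsto_slope.mono_left (nhdsWithin_mono 0 (t := {0}ᶜ) (s := Set.Ioi 0)
    fun x (hx : 0 < x) ↦ hx.ne')
  have h2 := (h.log one_ne_zero).neg
  rw [Real.log_one, neg_zero] at h2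
  refine h2.congr' ?_
  filter_upwards [self_mem_nhdsWithin] with s hs
  have hs : 0 < s := hs
  have hpos : 0 < 1 - Real.exp (-s) := by
    have : Real.exp (-s) < 1 := by rw [Real.exp_lt_one_iff]; linarith
    linarith
  have : slope (fun s : ℝ ↦ -Real.exp (-s)) 0 s = (1 - Real.exp (-s)) / s := by
    rw [slope_def_field]
    simp
    ring
  rw [this, Real.log_div hpos.ne' hs.ne']
  ring

open Finset in
/-- The sum of `-log (1 - 1 / p)` over the primes `p ≤ e ^ u`. -/
noncomputable def primeWeightSum (u : ℝ) : ℝ :=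
  ∑ i ∈ range (⌊Real.exp u⌋₊ + 1), primeWeight i

open Finset in
/-- The sum of `1 / m` over the positive integers `m ≤ u`. -/
noncomputable def harmonicSum (u : ℝ) : ℝ :=
  ∑ i ∈ range (⌊u⌋₊ + 1), 1 / (i : ℝ)

lemma primeWeightSum_nonneg (u : ℝ) : 0 ≤ primeWeightSum u :=
  Finset.sum_nonneg fun i _ ↦ primeWeight_nonneg i

lemma harmonicSum_nonneg (u : ℝ) : 0 ≤ harmonicSum u :=
  Finset.sum_nonneg fun i _ ↦ by positivity

lemma primeWeightSum_mono : Monotone primeWeightSum := fun _ _ huv ↦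
  Finset.sum_le_sum_of_subset_of_nonneg
    (Finset.range_mono (Nat.succ_le_succ (Nat.floor_mono (Real.exp_le_exp.mpr huv))))
    fun i _ _ ↦ primeWeight_nonneg i

lemma harmonicSum_mono : Monotone harmonicSum := fun _ _ huv ↦
  Finset.sum_le_sum_of_subset_of_nonneg
    (Finset.range_mono (Nat.succ_le_succ (Nat.floor_mono huv)))
    fun i _ _ ↦ by positivity

lemma hasSum_primeWeightSum (u : ℝ) :
    HasSum (fun n : ℕ ↦ if Real.log n ≤ u then primeWeight n else 0) (primeWeightSum u) := by
  have hle {n : ℕ} (hn : n ≠ 0) : n ∈ Finset.range (⌊Real.exp u⌋₊ + 1) ↔ Real.log n ≤ u := by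
    rw [Finset.mem_range, Nat.lt_succ_iff, Nat.le_floor_iff' hn,
      Real.log_le_iff_le_exp (by positivity)]
  have h0 : primeWeight 0 = 0 := by simp [primeWeight, Nat.not_prime_zero]
  rw [primeWeightSum, ← Finset.sum_congr rfl fun n hn ↦ ?_]
  · refine hasSum_sum_of_ne_finset_zero fun n hn ↦ ?_
    rcases eq_or_ne n 0 with rfl | h
    · simp [h0]
    · rw [if_neg (fun hc ↦ hn ((hle h).mpr hc))]
  · rcases eq_or_ne n 0 with rfl | h
    · simp [h0]
    · rw [if_pos ((hle h).mp hn)]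

lemma hasSum_harmonicSum (u : ℝ) :
    HasSum (fun n : ℕ ↦ if (n : ℝ) ≤ u then 1 / (n : ℝ) else 0) (harmonicSum u) := by
  have hle {n : ℕ} (hn : n ≠ 0) : n ∈ Finset.range (⌊u⌋₊ + 1) ↔ (n : ℝ) ≤ u := by
    rw [Finset.mem_range, Nat.lt_succ_iff, Nat.le_floor_iff' hn]
  rw [harmonicSum, ← Finset.sum_congr rfl fun n hn ↦ ?_]
  · refine hasSum_sum_of_ne_finset_zero fun n hn ↦ ?_
    rcases eq_or_ne n 0 with rfl | h
    · simp
    · rw [if_neg (fun hc ↦ hn ((hle h).mpr hc))]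
  · rcases eq_or_ne n 0 with rfl | h
    · simp
    · rw [if_pos ((hle h).mp hn)]

open Topology in
lemma tendsto_log_floor_sub_log :
    Tendsto (fun x : ℝ ↦ Real.log (⌊x⌋₊ : ℝ) - Real.log x) atTop (𝓝 0) := by
  have h := (tendsto_nat_floor_div_atTop (R := ℝ)).log one_ne_zero
  rw [Real.log_one] at h
  refine h.congr' ?_
  filter_upwards [eventually_ge_atTop 1] with x hx
  have : 0 < ⌊x⌋₊ := Nat.floor_pos.mpr hx
  rw [Real.log_div (by positivity) (by positivity)]

open Topology in
lemma tendsto_harmonicSum_sub_log :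
    Tendsto (fun u ↦ harmonicSum u - Real.log u) atTop (𝓝 Real.eulerMascheroniConstant) := by
  have h := (Real.tendsto_harmonic_sub_log.comp (tendsto_nat_floor_atTop (α := ℝ))).add
    tendsto_log_floor_sub_log
  rw [add_zero] at h
  refine h.congr fun u ↦ ?_
  simp only [Function.comp_apply, harmonicSum, Finset.sum_range_succ', harmonic]
  simp

open Topology in
lemma exists_tendsto_primeWeightSum_sub_log :
    ∃ c : ℝ, Tendsto (fun u ↦ primeWeightSum u - Real.log u) atTop (𝓝 c) := by
  obtain ⟨c, hc⟩ := exists_tendsto_sum_primeWeight_sub_log_log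
  have hfl : Tendsto (fun u : ℝ ↦ ⌊Real.exp u⌋₊) atTop atTop :=
    tendsto_nat_floor_atTop.comp Real.tendsto_exp_atTop
  have h1 := hc.comp ((tendsto_add_atTop_nat 1).comp hfl)
  have hdiff : Tendsto (fun u : ℝ ↦ Real.log ((⌊Real.exp u⌋₊ : ℝ) + 1) - u) atTop (𝓝 0) := by
    have h2 := ((Real.tendsto_log_comp_add_sub_log 1).comp
      (tendsto_natCast_atTop_atTop.comp hfl)).add
      (tendsto_log_floor_sub_log.comp Real.tendsto_exp_atTop)
    rw [add_zero] at h2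
    refine h2.congr fun u ↦ ?_
    simp
  have hratio : Tendsto (fun u : ℝ ↦ Real.log ((⌊Real.exp u⌋₊ : ℝ) + 1) / u) atTop (𝓝 1) := by
    have h3 := (hdiff.div_atTop tendsto_id).add_const 1
    rw [zero_add] at h3
    refine h3.congr' ?_
    filter_upwards [eventually_gt_atTop 0] with u hu
    simp only [id]
    field_simp
    ring
  have h4 := hratio.log one_ne_zero
  rw [Real.log_one] at h4
  have h5 := h1.add h4
  refine ⟨_, h5.congr' ?_⟩
  filter_upwards [eventually_gt_atTop 0] with u hu
  have hpos : 0 < Real.log ((⌊Real.exp u⌋₊ : ℝ) + 1) :=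
    hu.trans ((Real.lt_log_iff_exp_lt (by positivity)).mpr (Nat.lt_floor_add_one _))
  rw [Real.log_div hpos.ne' hu.ne']
  simp only [Function.comp_apply, primeWeightSum]
  push_cast
  ring

open Topology in
/-- Mertens' third theorem in logarithmic form:
`∑_{p ≤ e ^ u} -log (1 - 1 / p) = log u + γ + o(1)`. -/
lemma tendsto_primeWeightSum_sub_log :
    Tendsto (fun u ↦ primeWeightSum u - Real.log u) atTop (𝓝 Real.eulerMascheroniConstant) := by
  obtain ⟨c, hc⟩ := exists_tendsto_primeWeightSum_sub_log
  set D : ℝ → ℝ := fun u ↦ primeWeightSum u - harmonicSum u with hD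
  have hDlim : Tendsto D atTop (𝓝 (c - Real.eulerMascheroniConstant)) :=
    (hc.sub tendsto_harmonicSum_sub_log).congr fun u ↦ by simp only [hD]; ring
  have hmeas : Measurable D := primeWeightSum_mono.measurable.sub harmonicSum_mono.measurable
  obtain ⟨U, hU⟩ := eventually_atTop.mp (hDlim.abs.eventually_lt_const (lt_add_one _))
  have hbound (u : ℝ) (_ : 0 ≤ u) : |D u| ≤
      (|c - Real.eulerMascheroniConstant| + 1) + primeWeightSum U + harmonicSum U := by
    have p1 := primeWeightSum_nonneg U
    have q1 := harmonicSum_nonneg U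
    rcases le_total U u with h | h
    · linarith [hU u h]
    · have p2 := primeWeightSum_mono h
      have q2 := harmonicSum_mono h
      have p3 := primeWeightSum_nonneg u
      have q3 := harmonicSum_nonneg u
      have := abs_nonneg (c - Real.eulerMascheroniConstant)
      rw [abs_le]
      simp only [hD]
      constructor <;> linarith
  have habel := tendsto_integral_comp_div_mul_exp_neg hmeas hbound hDlim
  have hzero := tendsto_tsum_primeWeight_mul_exp_add_log.sub
    tendsto_neg_log_one_sub_exp_neg_add_log
  rw [sub_zero] at hzero
  have heq : c - Real.eulerMascheroniConstant = 0 := by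
    refine tendsto_nhds_unique (habel.congr' ?_) hzero
    filter_upwards [self_mem_nhdsWithin] with s hs
    have hs : 0 < s := hs
    set a : ℕ ⊕ ℕ → ℝ := Sum.elim primeWeight fun m ↦ -(1 / (m : ℝ)) with ha
    set l : ℕ ⊕ ℕ → ℝ := Sum.elim (fun n ↦ Real.log n) fun m ↦ (m : ℝ) with hl
    have hl0 (i : ℕ ⊕ ℕ) : 0 ≤ l i := by
      rcases i with n | m
      · exact Real.log_natCast_nonneg n
      · exact m.cast_nonneg
    have hDsum (u : ℝ) : HasSum (fun i ↦ if l i ≤ u then a i else 0) (D u) := by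
      simp only [hD, sub_eq_add_neg]
      refine HasSum.sum (hasSum_primeWeightSum u) ((hasSum_harmonicSum u).neg.congr_fun fun m ↦ ?_)
      simp only [Function.comp_apply, ha, hl, Sum.elim_inr]
      by_cases hm : (m : ℝ) ≤ u <;> simp [hm]
    have hP := (summable_primeWeight_mul_exp hs).hasSum
    have hH := hasSum_one_div_mul_exp hs
    have habs : Summable fun i ↦ |a i| * Real.exp (-(s * l i)) := by
      refine (HasSum.sum (hP.congr_fun fun n ↦ ?_) (hH.congr_fun fun m ↦ ?_)).summable
      · simp only [Function.comp_apply, ha, hl, Sum.elim_inl, abs_of_nonneg (primeWeight_nonneg n)]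
      · simp only [Function.comp_apply, ha, hl, Sum.elim_inr, abs_neg]
        rw [abs_of_nonneg (by positivity)]
    have hval : HasSum (fun i ↦ a i * Real.exp (-(s * l i)))
        ((∑' n : ℕ, primeWeight n * Real.exp (-(s * Real.log n)))
          + -(-Real.log (1 - Real.exp (-s)))) := by
      refine HasSum.sum (hP.congr_fun fun n ↦ ?_) (hH.neg.congr_fun fun m ↦ ?_)
      · simp only [Function.comp_apply, ha, hl, Sum.elim_inl]
      · simp only [Function.comp_apply, ha, hl, Sum.elim_inr, neg_mul]
    rw [(hasSum_mul_exp_neg_integral hl0 hDsum hs habs).unique hval]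
    ring
  rwa [sub_eq_zero.mp heq] at hc

open Topology

lemma eulerProd_count_prime (n : ℕ) :
    eulerProd (Nat.count Nat.Prime n) = Real.exp (-∑ i ∈ Finset.range n, primeWeight i) := by
  induction n with
  | zero => simp [eulerProd]
  | succ n ih =>
    rw [Nat.count_succ, Finset.sum_range_succ, neg_add, Real.exp_add, ← ih]
    by_cases hn : n.Prime
    · have h2 := hn.one_div_le_half
      rw [if_pos hn, primeWeight, if_pos hn, neg_neg, Real.exp_log (by linarith), eulerProd,
        Finset.prod_range_succ, Nat.nth_count hn, eulerProd]
    · simp [hn, primeWeight]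

lemma eulerProd_nonneg (j : ℕ) : 0 ≤ eulerProd j :=
  Finset.prod_nonneg fun i _ ↦ by
    have := (Nat.prime_nth_prime i).one_div_le_half
    linarith

lemma eulerProd_antitone : Antitone eulerProd := by
  refine antitone_nat_of_succ_le fun j ↦ ?_
  rw [eulerProd, Finset.prod_range_succ]
  refine mul_le_of_le_one_right (eulerProd_nonneg j) ?_
  have : (0 : ℝ) ≤ 1 / (Nat.nth Nat.Prime j : ℝ) := by positivity
  linarith

lemma sieveIndex_mono : Monotone sieveIndex := fun _ _ h ↦
  Nat.monotone_primeCounting (Nat.sqrt_le_sqrt (Nat.floor_mono h))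

lemma sqrt_floor_eq_floor_sqrt (x : ℝ) : Nat.sqrt ⌊x⌋₊ = ⌊√x⌋₊ := by
  rcases le_or_gt x 0 with hx | hx
  · simp [Nat.floor_of_nonpos hx, Real.sqrt_eq_zero_of_nonpos hx]
  · refine eq_of_forall_le_iff fun m ↦ ?_
    rw [Nat.le_sqrt', Nat.le_floor_iff hx.le, Nat.le_floor_iff (Real.sqrt_nonneg x),
      Real.le_sqrt (Nat.cast_nonneg m) hx.le, Nat.cast_pow]

lemma eulerProd_sieveIndex {t : ℝ} (ht : 0 < t) :
    eulerProd (sieveIndex t) = Real.exp (-primeWeightSum (Real.log t / 2)) := by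
  rw [primeWeightSum, ← Real.log_sqrt ht.le, Real.exp_log (Real.sqrt_pos.2 ht),
    ← sqrt_floor_eq_floor_sqrt, ← eulerProd_count_prime]
  rfl

lemma tendsto_eulerProd_sieveIndex_mul_log :
    Tendsto (fun t ↦ eulerProd (sieveIndex t) * Real.log t) atTop
      (𝓝 (2 * Real.exp (-Real.eulerMascheroniConstant))) := by
  have hu : Tendsto (fun t : ℝ ↦ Real.log t / 2) atTop atTop :=
    Real.tendsto_log_atTop.atTop_div_const two_pos
  have h := (((Real.continuous_exp.tendsto _).comp
    (tendsto_primeWeightSum_sub_log.comp hu).neg).const_mul 2)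
  refine h.congr' ?_
  filter_upwards [eventually_gt_atTop 1] with t ht
  have hlog : 0 < Real.log t / 2 := half_pos (Real.log_pos ht)
  simp only [Function.comp_apply]
  rw [eulerProd_sieveIndex (one_pos.trans ht), neg_sub, sub_eq_add_neg, Real.exp_add,
    Real.exp_log hlog]
  ring

lemma sieveIndex_eq_succ {j : ℕ} {t : ℝ} (h₁ : (Nat.nth Nat.Prime j : ℝ) ^ 2 ≤ t)
    (h₂ : t < (Nat.nth Nat.Prime (j + 1) : ℝ) ^ 2) : sieveIndex t = j + 1 := by
  have ht : 0 ≤ t := (sq_nonneg _).trans h₁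
  have hle : Nat.nth Nat.Prime j ≤ Nat.sqrt ⌊t⌋₊ := by
    rw [Nat.le_sqrt']
    exact Nat.le_floor (by exact_mod_cast h₁)
  have hlt : Nat.sqrt ⌊t⌋₊ < Nat.nth Nat.Prime (j + 1) := by
    rw [Nat.sqrt_lt', Nat.floor_lt ht]
    exact_mod_cast h₂
  have hinf := Nat.infinite_setOfPred_prime
  change Nat.count Nat.Prime (Nat.sqrt ⌊t⌋₊ + 1) = j + 1
  apply le_antisymm
  · exact (Nat.count_monotone _ hlt).trans (Nat.count_nth_of_infinite hinf (j + 1)).le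
  · rw [← Nat.count_nth_succ_of_infinite hinf j]
    exact Nat.count_monotone _ (by lia)

lemma nth_prime_sq_lt_nth_prime_succ_sq (j : ℕ) :
    (Nat.nth Nat.Prime j : ℝ) ^ 2 < (Nat.nth Nat.Prime (j + 1) : ℝ) ^ 2 := by
  have h := Nat.nth_strictMono Nat.infinite_setOfPred_prime (Nat.lt_succ_self j)
  exact_mod_cast Nat.pow_lt_pow_left h two_ne_zero

lemma intervalIntegrable_eulerProd_sieveIndex (a b : ℝ) :
    IntervalIntegrable (fun t ↦ eulerProd (sieveIndex t)) MeasureTheory.volume a b :=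
  (eulerProd_antitone.comp_monotone sieveIndex_mono).intervalIntegrable

lemma integral_eulerProd_sieveIndex_eq {a b : ℝ} {k : ℕ} (hab : a ≤ b)
    (h : ∀ t ∈ Set.Ioo a b, sieveIndex t = k) :
    ∫ t in a..b, eulerProd (sieveIndex t) = (b - a) * eulerProd k := by
  rw [intervalIntegral.integral_congr_Ioo_of_le (g := fun _ ↦ eulerProd k) hab
    fun t ht ↦ by simp only [h t ht], intervalIntegral.integral_const, smul_eq_mul]

lemma ptilde_eq_integral {x : ℝ} (hx : 4 ≤ x) :
    ptilde x = ∫ t in (4 : ℝ)..x, eulerProd (sieveIndex t) := by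
  set a : ℕ → ℝ := fun j ↦ (Nat.nth Nat.Prime j : ℝ) ^ 2 with ha
  have ha0 : a 0 = 4 := by
    simp only [ha, Nat.nth_prime_zero_eq_two]
    norm_num
  have hmono : StrictMono a := strictMono_nat_of_lt_succ nth_prime_sq_lt_nth_prime_succ_sq
  have hk1 : 1 ≤ sieveIndex x := by
    exact (sieveIndex_eq_succ (j := 0) ha0.le (ha0 ▸ hmono zero_lt_one)).ge.trans
      (sieveIndex_mono hx)
  obtain ⟨k, hk⟩ : ∃ k, sieveIndex x = k + 1 := ⟨sieveIndex x - 1, by lia⟩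
  have hak : a k ≤ x := by
    have h : Nat.nth Nat.Prime k < Nat.sqrt ⌊x⌋₊ + 1 := Nat.nth_lt_of_lt_count (by
      change k < sieveIndex x
      lia)
    rw [Nat.lt_succ_iff, Nat.le_sqrt', Nat.le_floor_iff (by linarith)] at h
    simpa only [ha, Nat.cast_pow] using h
  have hlast : ∫ t in a k..x, eulerProd (sieveIndex t) = (x - a k) * eulerProd (k + 1) :=
    integral_eulerProd_sieveIndex_eq hak fun t ht ↦ le_antisymm
      (hk ▸ sieveIndex_mono ht.2.le)
      ((sieveIndex_eq_succ le_rfl (hmono k.lt_succ_self)).symm.le.trans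
        (sieveIndex_mono ht.1.le))
  have hsum : ∑ j ∈ Finset.range k, (a (j + 1) - a j) * eulerProd (j + 1) =
      ∫ t in a 0..a k, eulerProd (sieveIndex t) := by
    rw [← intervalIntegral.sum_integral_adjacent_intervals
      fun j _ ↦ intervalIntegrable_eulerProd_sieveIndex _ _]
    exact Finset.sum_congr rfl fun j _ ↦ (integral_eulerProd_sieveIndex_eq
      (hmono j.lt_succ_self).le fun t ht ↦ sieveIndex_eq_succ ht.1.le ht.2).symm
  rw [ptilde, hk, Nat.add_sub_cancel]
  change ∑ j ∈ Finset.range k, (a (j + 1) - a j) * eulerProd (j + 1) +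
    (x - a k) * eulerProd (k + 1) = _
  rw [hsum, ← hlast, intervalIntegral.integral_add_adjacent_intervals
    (intervalIntegrable_eulerProd_sieveIndex _ _) (intervalIntegrable_eulerProd_sieveIndex _ _),
    ha0]

lemma tendsto_integral_div_integral {f g : ℝ → ℝ} {a C : ℝ}
    (hf : ∀ x ≥ a, IntervalIntegrable f MeasureTheory.volume a x)
    (hg : ∀ x ≥ a, IntervalIntegrable g MeasureTheory.volume a x)
    (hpos : ∀ x ≥ a, 0 < g x)
    (hlim : Tendsto (fun x ↦ f x / g x) atTop (𝓝 C))
    (hinf : Tendsto (fun x ↦ ∫ t in a..x, g t) atTop atTop) :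
    Tendsto (fun x ↦ (∫ t in a..x, f t) / ∫ t in a..x, g t) atTop (𝓝 C) := by
  rw [Metric.tendsto_atTop'] at hlim
  rw [Metric.tendsto_nhds]
  intro ε hε
  obtain ⟨T₀, hT₀⟩ := hlim (ε / 2) (half_pos hε)
  set T := max a T₀ with hT
  have haT : a ≤ T := le_max_left _ _
  set K := |∫ t in a..T, (f t - C * g t)| with hK
  filter_upwards [eventually_ge_atTop T, hinf.eventually_gt_atTop 0,
    hinf.eventually_gt_atTop (2 * K / ε)] with x hxT hx0 hxK
  have hax := haT.trans hxT
  have hw : ∀ y ≥ a, IntervalIntegrable (fun t ↦ f t - C * g t) MeasureTheory.volume a y :=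
    fun y hy ↦ (hf y hy).sub ((hg y hy).const_mul C)
  have hgT : IntervalIntegrable g MeasureTheory.volume T x := (hg T haT).symm.trans (hg x hax)
  have htail : |∫ t in T..x, (f t - C * g t)| ≤ ε / 2 * ∫ t in T..x, g t := by
    rw [← Real.norm_eq_abs, ← intervalIntegral.integral_const_mul]
    refine intervalIntegral.norm_integral_le_of_norm_le hxT (.of_forall fun t ht ↦ ?_)
      (hgT.const_mul _)
    have hgt := hpos t (haT.trans ht.1.le)
    have h := (hT₀ t ((le_max_right _ _).trans_lt ht.1)).le
    rw [Real.dist_eq, div_sub' hgt.ne', abs_div, abs_of_pos hgt, div_le_iff₀ hgt] at h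
    rwa [Real.norm_eq_abs, mul_comm C]
  have hgle : ∫ t in T..x, g t ≤ ∫ t in a..x, g t := by
    rw [← intervalIntegral.integral_add_adjacent_intervals (hg T haT) hgT]
    have : 0 ≤ ∫ t in a..T, g t :=
      intervalIntegral.integral_nonneg haT fun t ht ↦ (hpos t ht.1).le
    linarith
  have hsplit : (∫ t in a..x, f t) - C * ∫ t in a..x, g t =
      (∫ t in a..T, (f t - C * g t)) + ∫ t in T..x, (f t - C * g t) := by
    rw [intervalIntegral.integral_add_adjacent_intervals (hw T haT)
      ((hw T haT).symm.trans (hw x hax)), intervalIntegral.integral_sub (hf x hax)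
      ((hg x hax).const_mul C), intervalIntegral.integral_const_mul]
  have hmain : |(∫ t in a..x, f t) - C * ∫ t in a..x, g t| < ε * ∫ t in a..x, g t := by
    rw [div_lt_iff₀ hε] at hxK
    rw [hsplit]
    refine (abs_add_le _ _).trans_lt ?_
    nlinarith
  rw [Real.dist_eq, div_sub' hx0.ne', abs_div, abs_of_pos hx0, div_lt_iff₀ hx0, mul_comm _ C]
  exact hmain

lemma intervalIntegrable_one_div_log {a b : ℝ} (ha : 1 < a) (hab : a ≤ b) :
    IntervalIntegrable (fun t ↦ 1 / Real.log t) MeasureTheory.volume a b := by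
  refine ContinuousOn.intervalIntegrable ?_
  rw [Set.uIcc_of_le hab]
  exact continuousOn_const.div
    (Real.continuousOn_log.mono fun t ht ↦ (one_pos.trans (ha.trans_le ht.1)).ne')
    fun t ht ↦ (Real.log_pos (ha.trans_le ht.1)).ne'

lemma tendsto_li_atTop : Tendsto li atTop atTop := by
  have h : Tendsto (fun x : ℝ ↦ Real.log (x / 2)) atTop atTop :=
    Real.tendsto_log_atTop.comp (tendsto_id.atTop_div_const two_pos)
  refine tendsto_atTop_mono' _ ?_ h
  filter_upwards [eventually_ge_atTop 2] with x hx
  rw [← integral_one_div_of_pos two_pos (by linarith), li]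
  refine intervalIntegral.integral_mono_on hx ?_
    (intervalIntegrable_one_div_log one_lt_two hx) fun t ht ↦ ?_
  · refine intervalIntegral.intervalIntegrable_one_div (fun t ht ↦ ?_) continuousOn_id
    rw [Set.uIcc_of_le hx] at ht
    exact (two_pos.trans_le ht.1).ne'
  · have ht2 : 2 ≤ t := ht.1
    exact one_div_le_one_div_of_le (Real.log_pos (by linarith)) (Real.log_le_self (by linarith))

/-- `π̃(x) ~ 2e^{-γ} li(x)` as `x → ∞`. -/
theorem ptilde_asymp :
    Tendsto (fun x : ℝ =>
        ptilde x / (2 * Real.exp (-Real.eulerMascheroniConstant) * li x))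
      atTop (nhds 1) := by
  set C := 2 * Real.exp (-Real.eulerMascheroniConstant) with hC
  have hC0 : C ≠ 0 := by positivity
  have havg : Tendsto (fun x ↦ (∫ t in (2 : ℝ)..x, eulerProd (sieveIndex t)) / li x) atTop
      (𝓝 C) := by
    refine tendsto_integral_div_integral
      (fun x _ ↦ intervalIntegrable_eulerProd_sieveIndex 2 x)
      (fun x hx ↦ intervalIntegrable_one_div_log one_lt_two hx)
      (fun x hx ↦ one_div_pos.2 (Real.log_pos (one_lt_two.trans_le hx))) ?_ tendsto_li_atTop
    simpa using tendsto_eulerProd_sieveIndex_mul_log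
  have hinit : Tendsto (fun x ↦ (∫ t in (2 : ℝ)..4, eulerProd (sieveIndex t)) / li x) atTop
      (𝓝 0) := tendsto_li_atTop.const_div_atTop _
  have h := (havg.sub hinit).div_const C
  rw [sub_zero, div_self hC0] at h
  refine h.congr' ?_
  filter_upwards [eventually_ge_atTop 4] with x hx
  rw [ptilde_eq_integral hx, ← sub_div, intervalIntegral.integral_interval_sub_left
    (intervalIntegrable_eulerProd_sieveIndex _ _) (intervalIntegrable_eulerProd_sieveIndex _ _),
    div_div, mul_comm C]
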